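/- Let c = c^cr = 1/(4 log 2) and C₀ = −6/log(1 − c/2). For all constants T > 0 and K > 0 and every ε > 0 there exists N₀ such that for every integer N ≥ N₀, every integer j with C₀·log N < j ≤ T·N^{4/3}, every nondecreasing sequence 𝐀 = (A₁ ⊆ A₂ ⊆ … ⊆ A_j) of subsets of V_N with |A_j| ≤ K·N^{4/3}, every a ∈ V_N and every b ∈ V_N ∖ (A_j ∪ {a}): |N²·Q(𝐀,j; a,b) − 1| ≤ ε; that is, the self-avoiding walk with memory is asymptotically uniformly distributed on V_N. -/

import Mathlib

open scoped BigOperators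

/-- Vertices of the discrete 2-dimensional torus. -/
abbrev Vtx (N : ℕ) : Type := ZMod N × ZMod N

/-- `ρ_N(i)`: for a residue represented in `{0,…,N−1}`, `ρ_N(i) = i` if `i ≤ N/2`
and `ρ_N(i) = N − i` otherwise. -/
def rhoN (N : ℕ) (i : ZMod N) : ℕ :=
  if 2 * i.val ≤ N then i.val else N - i.val

/-- Torus distance `ρ(u,v) = ρ_N(u₁ − v₁) + ρ_N(u₂ − v₂)`. -/
def torusDist (N : ℕ) (u v : Vtx N) : ℕ :=
  rhoN N (u.1 - v.1) + rhoN N (u.2 - v.2)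

/-- Connection probability `p(u,v) = min(c/(N·ρ(u,v)), 1)` for `u ≠ v`, `p(u,u) = 0`. -/
noncomputable def edgeProb (N : ℕ) (c : ℝ) (u v : Vtx N) : ℝ :=
  if u = v then 0 else min (c / ((N : ℝ) * (torusDist N u v : ℝ))) 1

/-- The critical value `c^cr = 1/(4 log 2)`. -/
noncomputable def ccr : ℝ := 1 / (4 * Real.log 2)

/-- `Z_{N,A}(u) = Σ_{v ∈ V_N∖A, v ≠ u} p(u,v)`. -/
noncomputable def ZNA (N : ℕ) [NeZero N] (c : ℝ) (A : Finset (Vtx N)) (u : Vtx N) : ℝ :=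
  ∑ v ∈ (Finset.univ \ A).erase u, edgeProb N c u v

/-- Transition kernel of the chain avoiding `A`:
`P_A(u,v) = p(u,v)/Z_{N,A}(u)` for `v ∉ A`, and `0` for `v ∈ A`. -/
noncomputable def transPA (N : ℕ) [NeZero N] (c : ℝ) (A : Finset (Vtx N))
    (u v : Vtx N) : ℝ :=
  if v ∈ A then 0 else edgeProb N c u v / ZNA N c A u

/-- Auxiliary recursion for the memory-walk kernel: `memQ i m H x b` is the sum over
paths of `m` further steps, starting from `x` at time `i` with history `H`, where the
`i`-th step uses the kernel `P_{A_i ∪ H}` (which vanishes on targets in `A_i ∪ H`). -/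
noncomputable def memQ (N : ℕ) [NeZero N] (c : ℝ) (A : ℕ → Finset (Vtx N)) :
    ℕ → ℕ → Finset (Vtx N) → Vtx N → Vtx N → ℝ
  | _, 0, _, x, b => if x = b then 1 else 0
  | i, m + 1, H, x, b =>
      ∑ y : Vtx N, transPA N c (A i ∪ H) x y * memQ N c A (i + 1) m (insert y H) y b

/-- The `k`-step memory-walk kernel `Q(𝐀,k;a,b)`: the sum over all tuples
`(u₂,…,u_k)` with `u_i ∉ A_{i−1} ∪ {a,u₂,…,u_{i−1}}` of
`P_{A₁∪{a}}(a,u₂)·P_{A₂∪{a,u₂}}(u₂,u₃)·…·P_{A_k∪{a,u₂,…,u_k}}(u_k,b)`. -/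
noncomputable def kernelQ (N : ℕ) [NeZero N] (c : ℝ) (A : ℕ → Finset (Vtx N))
    (k : ℕ) (a b : Vtx N) : ℝ :=
  memQ N c A 1 k {a} a b


section Abs
variable {V : Type*} [Fintype V] [DecidableEq V] (P : Matrix V V ℝ)

lemma pw_succ (m : ℕ) (x b : V) : (P ^ (m + 1)) x b = ∑ y, P x y * (P ^ m) y b := by
  rw [pow_succ', Matrix.mul_apply]

lemma pw_symm (h : ∀ x y, P x y = P y x) (m : ℕ) (x b : V) : (P ^ m) x b = (P ^ m) b x := by
  have hT : P.transpose = P := by ext x y; exact h y x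
  have := Matrix.transpose_pow P m
  rw [hT] at this
  exact (congrFun (congrFun this b) x)

lemma pw_nonneg (h0 : ∀ x y, 0 ≤ P x y) (m : ℕ) (x b : V) : 0 ≤ (P ^ m) x b := by
  induction m generalizing x with
  | zero => simp [Matrix.one_apply]; split_ifs <;> norm_num
  | succ m ih =>
    rw [pw_succ]
    exact Finset.sum_nonneg fun y _ => mul_nonneg (h0 _ _) (ih y)

lemma avg_le (h0 : ∀ x y, 0 ≤ P x y) (h1 : ∀ x, ∑ y, P x y = 1) (f : V → ℝ) (C : ℝ)
    (hf : ∀ y, f y ≤ C) (x : V) : ∑ y, P x y * f y ≤ C := by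
  calc ∑ y, P x y * f y ≤ ∑ y, P x y * C :=
        Finset.sum_le_sum fun y _ => mul_le_mul_of_nonneg_left (hf y) (h0 _ _)
    _ = C := by rw [← Finset.sum_mul, h1, one_mul]

lemma pw_le (h0 : ∀ x y, 0 ≤ P x y) (h1 : ∀ x, ∑ y, P x y = 1) (k : ℕ) (C : ℝ)
    (hC : ∀ x y, (P ^ k) x y ≤ C) (m : ℕ) (hm : k ≤ m) (x b : V) : (P ^ m) x b ≤ C := by
  induction m, hm using Nat.le_induction generalizing x with
  | base => exact hC x b
  | succ m _ ih =>
    rw [pw_succ]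
    exact avg_le P h0 h1 _ _ (fun y => ih y) x

lemma pw_sum_le (h0 : ∀ x y, 0 ≤ P x y) (h1 : ∀ x, ∑ y, P x y = 1) (F : Finset V) (θ : ℝ)
    (hF : ∀ x, ∑ z ∈ F, P x z ≤ θ) (m : ℕ) (hm : 1 ≤ m) (x : V) :
    ∑ z ∈ F, (P ^ m) x z ≤ θ := by
  induction m, hm using Nat.le_induction generalizing x with
  | base => simpa using hF x
  | succ m _ ih =>
    have : ∑ z ∈ F, (P ^ (m + 1)) x z = ∑ y, P x y * ∑ z ∈ F, (P ^ m) y z := by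
      simp_rw [pw_succ, Finset.mul_sum]
      exact Finset.sum_comm
    rw [this]
    exact avg_le P h0 h1 _ _ (fun y => ih y) x

lemma contr (hs : ∀ x y, P x y = P y x) (h0 : ∀ x y, 0 ≤ P x y)
    (h1 : ∀ x, ∑ y, P x y = 1) (β n : ℝ) (hn : n = Fintype.card V) (hn4 : 4 ≤ n)
    (hβ : 0 ≤ β) (hlow : ∀ u v, u ≠ v → β / n ≤ P u v) (hd : ∀ u, P u u = 0)
    (f : V → ℝ) (hf : ∑ y, f y = 0) (C : ℝ) (hC : ∀ y, |f y| ≤ C) (x : V) :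
    |∑ y, P x y * f y| ≤ (1 - β / 2) * C := by
  have hC0 : 0 ≤ C := (abs_nonneg _).trans (hC x)
  have e1 : ∑ y, P x y * f y = ∑ y, (P x y - β / n) * f y := by
    simp_rw [sub_mul, Finset.sum_sub_distrib, ← Finset.mul_sum, hf]; simp
  have e2 : ∑ y, |P x y - β / n| ≤ 1 - β / 2 := by
    have : ∀ y, |P x y - β / n| ≤ P x y - β / n + if y = x then 2 * (β / n) else 0 := by
      intro y
      have hb : 0 ≤ β / n := by positivity
      split_ifs with h
      · subst h; rw [hd, abs_le]; constructor <;> linarith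
      · rw [abs_of_nonneg]; · simp
        linarith [hlow x y (Ne.symm h)]
    refine (Finset.sum_le_sum fun y _ => this y).trans ?_
    rw [Finset.sum_add_distrib, Finset.sum_sub_distrib, h1]
    simp only [Finset.sum_const, Finset.card_univ, nsmul_eq_mul, ← hn, Finset.sum_ite_eq',
      Finset.mem_univ, if_true]
    have : n * (β / n) = β := by field_simp
    have h2 : β / n ≤ β / 4 := by gcongr
    linarith
  rw [e1]
  calc |∑ y, (P x y - β / n) * f y| ≤ ∑ y, |(P x y - β / n) * f y| :=
        Finset.abs_sum_le_sum_abs _ _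
    _ ≤ ∑ y, |P x y - β / n| * C := by
        refine Finset.sum_le_sum fun y _ => ?_
        rw [abs_mul]
        exact mul_le_mul_of_nonneg_left (hC y) (abs_nonneg _)
    _ = (∑ y, |P x y - β / n|) * C := by rw [Finset.sum_mul]
    _ ≤ _ := mul_le_mul_of_nonneg_right e2 hC0

lemma mixing (hs : ∀ x y, P x y = P y x) (h0 : ∀ x y, 0 ≤ P x y)
    (h1 : ∀ x, ∑ y, P x y = 1) (β n : ℝ) (hn : n = Fintype.card V) (hn4 : 4 ≤ n)
    (hβ : 0 ≤ β) (hlow : ∀ u v, u ≠ v → β / n ≤ P u v) (hd : ∀ u, P u u = 0)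
    (η : ℝ) (h2 : ∀ x y, (P ^ 2) x y ≤ η) (hη : 1 / n ≤ η) (b : V) (m : ℕ) (x : V) :
    |(P ^ (m + 2)) x b - 1 / n| ≤ (1 - β / 2) ^ m * η := by
  have hsum : ∀ m : ℕ, ∑ x, ((P ^ m) x b - 1 / n) = 0 := by
    intro m
    have : ∑ x, (P ^ m) x b = 1 := by
      induction m with
      | zero => simp [Matrix.one_apply]
      | succ m ih =>
        simp_rw [pw_succ]
        rw [Finset.sum_comm]
        simp_rw [← Finset.sum_mul, fun y => (Finset.sum_congr rfl fun x _ => hs x y :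
          ∑ x, P x y = ∑ x, P y x), h1, one_mul]
        exact ih
    rw [Finset.sum_sub_distrib, this]
    simp only [Finset.sum_const, Finset.card_univ, nsmul_eq_mul, ← hn]
    field_simp; simp
  induction m generalizing x with
  | zero =>
    have a := h2 x b
    have a0 := pw_nonneg P h0 2 x b
    have : 0 < 1 / n := by positivity
    simp only [zero_add, pow_zero, one_mul]
    rw [abs_le]; constructor <;> linarith
  | succ m ih =>
    have := contr P hs h0 h1 β n hn hn4 hβ hlow hd (fun y => (P ^ (m + 2)) y b - 1 / n)
      (hsum _) _ ih x
    have e : (P ^ (m + 1 + 2)) x b - 1 / n = ∑ y, P x y * ((P ^ (m + 2)) y b - 1 / n) := by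
      rw [show m + 1 + 2 = (m + 2) + 1 by ring, pw_succ]
      simp_rw [mul_sub, Finset.sum_sub_distrib, ← Finset.sum_mul, h1, one_mul]
    rw [e]
    refine this.trans (le_of_eq ?_)
    ring

/-- error term -/
noncomputable def errG (d : ℕ → ℝ) (b : V) (m : ℕ) (F : Finset V) (x : V) : ℝ :=
  ∑ s ∈ Finset.range m, (∑ z ∈ F, (P ^ (m - s)) x z * (P ^ s) z b +
    s * d (m - s) * (P ^ s) x b)

lemma errG_insert (h0 : ∀ x y, 0 ≤ P x y) (d : ℕ → ℝ)
    (hd : ∀ r, 1 ≤ r → ∀ y, (P ^ r) y y ≤ d r) (b : V) (m : ℕ) (F : Finset V) (y : V)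
    (hy : y ∉ F) :
    errG P d b m (insert y F) y ≤
      errG P d b m F y + ∑ s ∈ Finset.range m, d (m - s) * (P ^ s) y b := by
  unfold errG
  rw [← Finset.sum_add_distrib]
  refine Finset.sum_le_sum fun s hs => ?_
  rw [Finset.mem_range] at hs
  rw [Finset.sum_insert hy]
  have := mul_le_mul_of_nonneg_right (hd (m - s) (by omega) y) (pw_nonneg P h0 s y b)
  linarith

lemma errG_step (d : ℕ → ℝ) (b : V) (m : ℕ) (F : Finset V) (x : V) :
    ∑ z ∈ F, P x z * (P ^ m) z b + ∑ y, P x y * (errG P d b m F y +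
      ∑ s ∈ Finset.range m, d (m - s) * (P ^ s) y b) = errG P d b (m + 1) F x := by
  have e1 : ∑ y, P x y * (errG P d b m F y +
      ∑ s ∈ Finset.range m, d (m - s) * (P ^ s) y b) =
      ∑ s ∈ Finset.range m, ((∑ z ∈ F, (P ^ (m + 1 - s)) x z * (P ^ s) z b) +
        ((s + 1 : ℕ) : ℝ) * d (m + 1 - (s + 1)) * (P ^ (s + 1)) x b) := by
    unfold errG
    simp_rw [← Finset.sum_add_distrib, Finset.mul_sum]
    rw [Finset.sum_comm]
    refine Finset.sum_congr rfl fun s hs => ?_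
    rw [Finset.mem_range] at hs
    rw [show m + 1 - s = (m - s) + 1 by omega, show m + 1 - (s + 1) = m - s by omega]
    simp_rw [pw_succ, Finset.sum_mul, Finset.mul_sum]
    rw [Finset.sum_comm, ← Finset.sum_add_distrib]
    refine Finset.sum_congr rfl fun y _ => ?_
    rw [mul_add, mul_add, Finset.mul_sum]
    simp_rw [mul_assoc]
    push_cast
    ring
  rw [e1]
  unfold errG
  simp_rw [Finset.sum_add_distrib]
  rw [Finset.sum_range_succ (fun s => ∑ z ∈ F, (P ^ (m + 1 - s)) x z * (P ^ s) z b),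
    Finset.sum_range_succ' (fun s => (s : ℝ) * d (m + 1 - s) * (P ^ s) x b)]
  simp
  ring

lemma errG_le (hs : ∀ x y, P x y = P y x) (h0 : ∀ x y, 0 ≤ P x y)
    (h1 : ∀ x, ∑ y, P x y = 1) (δ η θ : ℝ) (hδ : ∀ x y, P x y ≤ δ)
    (h2 : ∀ x y, (P ^ 2) x y ≤ η) (hδ0 : 0 ≤ δ) (hη0 : 0 ≤ η) (hηδ : η ≤ δ)
    (hθ0 : 0 ≤ θ) (b : V) (m : ℕ)
    (hm : 3 ≤ m) (F : Finset V) (hF : ∀ x, ∑ z ∈ F, P x z ≤ θ) (hb : b ∉ F) (x : V) :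
    errG P (fun r => if r ≤ 1 then δ else η) b m F x ≤ m * (θ * η + m * (δ * η)) := by
  unfold errG
  have : ∀ s ∈ Finset.range m, (∑ z ∈ F, (P ^ (m - s)) x z * (P ^ s) z b +
    s * (if m - s ≤ 1 then δ else η) * (P ^ s) x b) ≤ θ * η + m * (δ * η) := by
    intro s hsm
    rw [Finset.mem_range] at hsm
    rcases Nat.eq_zero_or_pos s with rfl | hs1
    · have : ∑ z ∈ F, (P ^ (m - 0)) x z * (P ^ 0) z b = 0 := by
        refine Finset.sum_eq_zero fun z hz => ?_
        have : z ≠ b := by rintro rfl; exact hb hz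
        simp [this]
      rw [this]; simp; positivity
    refine add_le_add ?_ ?_
    · by_cases h : 2 ≤ s
      · calc ∑ z ∈ F, (P ^ (m - s)) x z * (P ^ s) z b ≤ ∑ z ∈ F, (P ^ (m - s)) x z * η :=
              Finset.sum_le_sum fun z _ => mul_le_mul_of_nonneg_left
                (pw_le P h0 h1 2 η h2 s h z b) (pw_nonneg P h0 _ _ _)
          _ ≤ θ * η := by
              rw [← Finset.sum_mul]
              exact mul_le_mul_of_nonneg_right
                (pw_sum_le P h0 h1 F θ hF _ (by omega) x) hη0
      · calc ∑ z ∈ F, (P ^ (m - s)) x z * (P ^ s) z b ≤ ∑ z ∈ F, η * (P ^ s) b z := by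
              refine Finset.sum_le_sum fun z _ => ?_
              rw [pw_symm P hs s z b]
              exact mul_le_mul_of_nonneg_right
                (pw_le P h0 h1 2 η h2 _ (by omega) x z) (pw_nonneg P h0 _ _ _)
          _ ≤ θ * η := by
              rw [← Finset.mul_sum, mul_comm θ]
              exact mul_le_mul_of_nonneg_left
                (pw_sum_le P h0 h1 F θ hF _ (by omega) b) hη0
    · rw [mul_assoc]
      have hsm' : (s : ℝ) ≤ m := by exact_mod_cast hsm.le
      have hp := pw_nonneg P h0 s x b
      have hδ' : ∀ x y, (P ^ 1) x y ≤ δ := by simpa using hδ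
      refine mul_le_mul hsm' ?_ ?_ (by positivity)
      · split_ifs with h
        · exact mul_le_mul_of_nonneg_left (pw_le P h0 h1 2 η h2 s (by omega) x b) hδ0
        · rw [mul_comm δ]
          exact mul_le_mul_of_nonneg_left (pw_le P h0 h1 1 δ hδ' s hs1 x b) hη0
      · split_ifs <;> positivity
  refine (Finset.sum_le_sum this).trans ?_
  simp [mul_add]
end Abs

section Walk
variable (N : ℕ) [NeZero N] (c : ℝ) (P : Matrix (Vtx N) (Vtx N) ℝ)

lemma memQ_nonneg (ht0 : ∀ B u v, 0 ≤ transPA N c B u v) (A : ℕ → Finset (Vtx N))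
    (i m : ℕ) (H : Finset (Vtx N)) (x b : Vtx N) : 0 ≤ memQ N c A i m H x b := by
  induction m generalizing i H x with
  | zero => rw [memQ]; split_ifs <;> norm_num
  | succ m ih =>
    rw [memQ]
    exact Finset.sum_nonneg fun y _ => mul_nonneg (ht0 _ _ _) (ih _ _ _)

lemma card_aux (S B H : Finset (Vtx N)) (h : B ⊆ S) (m M : ℕ)
    (hM : S.card + H.card + m ≤ M) : (B ∪ H).card ≤ M := by
  have := Finset.card_union_le B H
  have := Finset.card_le_card h
  omega

lemma card_aux2 (S H : Finset (Vtx N)) (y : Vtx N) (m M : ℕ)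
    (hM : S.card + H.card + (m + 1) ≤ M) : S.card + (insert y H).card + m ≤ M := by
  have := Finset.card_insert_le y H
  omega

lemma memQ_upper (ht0 : ∀ B u v, 0 ≤ transPA N c B u v) (M : ℕ) (U : ℝ) (hU : 0 ≤ U)
    (h0 : ∀ x y, 0 ≤ P x y)
    (ht1 : ∀ B u, u ∈ B → B.card ≤ M → ∀ v, transPA N c B u v ≤ U * P u v)
    (A : ℕ → Finset (Vtx N)) (S : Finset (Vtx N)) (b : Vtx N)
    (i m : ℕ) (H : Finset (Vtx N)) (x : Vtx N) (hx : x ∈ H)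
    (hA : ∀ l, i ≤ l → l < i + m → A l ⊆ S) (hM : S.card + H.card + m ≤ M) :
    memQ N c A i m H x b ≤ U ^ m * (P ^ m) x b := by
  induction m generalizing i H x with
  | zero => rw [memQ]; simp [Matrix.one_apply]
  | succ m ih =>
    rw [memQ, pw_succ, Finset.mul_sum]
    refine Finset.sum_le_sum fun y _ => ?_
    have a1 := ht1 (A i ∪ H) x (Finset.mem_union_right _ hx)
      (card_aux N S _ _ (hA i le_rfl (by omega)) _ _ hM) y
    have a2 := ih (i + 1) (insert y H) y (Finset.mem_insert_self _ _)
      (fun l h1 h2 => hA l (by omega) (by omega)) (card_aux2 N S H y m M hM)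
    calc _ ≤ (U * P x y) * (U ^ m * (P ^ m) y b) :=
          mul_le_mul a1 a2 (memQ_nonneg N c ht0 _ _ _ _ _ _) (mul_nonneg hU (h0 _ _))
      _ = _ := by ring

lemma memQ_upper2 (ht0 : ∀ B u v, 0 ≤ transPA N c B u v) (M : ℕ) (R : ℝ)
    (ht3 : ∀ B u, u ∈ B → B.card ≤ M → ∑ v, transPA N c B u v = 1)
    (A : ℕ → Finset (Vtx N)) (S : Finset (Vtx N)) (b : Vtx N) (e k : ℕ)
    (hR : ∀ (i : ℕ) (H : Finset (Vtx N)) (x : Vtx N), x ∈ H → i + k = e →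
      S.card + H.card + k ≤ M → memQ N c A i k H x b ≤ R)
    (n i : ℕ) (H : Finset (Vtx N)) (x : Vtx N) (hx : x ∈ H) (he : i + n + k = e)
    (hA : ∀ l, i ≤ l → l < e → A l ⊆ S) (hM : S.card + H.card + (n + k) ≤ M) :
    memQ N c A i (n + k) H x b ≤ R := by
  induction n generalizing i H x with
  | zero =>
    rw [Nat.zero_add] at hM ⊢
    exact hR i H x hx (by omega) hM
  | succ n ih =>
    rw [show n + 1 + k = (n + k) + 1 by ring] at hM ⊢
    rw [memQ]
    have a1 := ht3 (A i ∪ H) x (Finset.mem_union_right _ hx)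
      (card_aux N S _ _ (hA i le_rfl (by omega)) _ _ hM)
    calc _ ≤ ∑ y, transPA N c (A i ∪ H) x y * R := by
          refine Finset.sum_le_sum fun y _ => mul_le_mul_of_nonneg_left ?_ (ht0 _ _ _)
          exact ih (i + 1) (insert y H) y (Finset.mem_insert_self _ _) (by omega)
            (fun l h1 h2 => hA l (by omega) (by omega)) (card_aux2 N S H y _ M hM)
      _ = R := by rw [← Finset.sum_mul, a1, one_mul]

lemma memQ_lower (ht0 : ∀ B u v, 0 ≤ transPA N c B u v) (M : ℕ)
    (h0 : ∀ x y, 0 ≤ P x y)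
    (ht2 : ∀ B u, u ∈ B → B.card ≤ M → ∀ v, v ∉ B → P u v ≤ transPA N c B u v)
    (d : ℕ → ℝ) (hd : ∀ r, 1 ≤ r → ∀ y, (P ^ r) y y ≤ d r)
    (hd0 : ∀ r, 0 ≤ d r)
    (A : ℕ → Finset (Vtx N)) (S : Finset (Vtx N)) (b : Vtx N)
    (i m : ℕ) (H : Finset (Vtx N)) (x : Vtx N) (hx : x ∈ H)
    (hA : ∀ l, i ≤ l → l < i + m → A l ⊆ S) (hM : S.card + H.card + m ≤ M) :
    (P ^ m) x b - errG P d b m (S ∪ H) x ≤ memQ N c A i m H x b := by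
  induction m generalizing i H x with
  | zero => rw [memQ]; simp [Matrix.one_apply, errG]
  | succ m ih =>
    rw [memQ, pw_succ, ← errG_step]
    have key : ∀ y, P x y * (P ^ m) y b -
        ((if y ∈ S ∪ H then P x y * (P ^ m) y b else 0) +
        P x y * (errG P d b m (S ∪ H) y + ∑ s ∈ Finset.range m, d (m - s) * (P ^ s) y b)) ≤
        transPA N c (A i ∪ H) x y * memQ N c A (i + 1) m (insert y H) y b := by
      intro y
      have q0 := memQ_nonneg N c ht0 A (i + 1) m (insert y H) y b
      have hAi := hA i le_rfl (by omega)
      split_ifs with hy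
      · have e0 : 0 ≤ errG P d b m (S ∪ H) y := by
          unfold errG
          refine Finset.sum_nonneg fun s _ => add_nonneg (Finset.sum_nonneg fun z _ =>
            mul_nonneg (pw_nonneg P h0 _ _ _) (pw_nonneg P h0 _ _ _))
            (mul_nonneg (mul_nonneg (Nat.cast_nonneg _) (hd0 _)) (pw_nonneg P h0 _ _ _))
        have e1 : 0 ≤ ∑ s ∈ Finset.range m, d (m - s) * (P ^ s) y b :=
          Finset.sum_nonneg fun s _ => mul_nonneg (hd0 _) (pw_nonneg P h0 _ _ _)
        have e2 := mul_nonneg (h0 x y) (add_nonneg e0 e1)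
        have e3 := mul_nonneg (ht0 (A i ∪ H) x y) q0
        linarith
      · have a2 := ht2 (A i ∪ H) x (Finset.mem_union_right _ hx)
          (card_aux N S _ _ hAi _ _ hM) y
          (fun h => hy (Finset.union_subset_union_left hAi h))
        have a3 := ih (i + 1) (insert y H) y (Finset.mem_insert_self _ _)
          (fun l h1 h2 => hA l (by omega) (by omega)) (card_aux2 N S H y m M hM)
        rw [Finset.union_insert] at a3
        have a4 := errG_insert P h0 d hd b m (S ∪ H) y hy
        have a5 := mul_le_mul_of_nonneg_right a2 q0
        have a6 : P x y * ((P ^ m) y b - (errG P d b m (S ∪ H) y +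
            ∑ s ∈ Finset.range m, d (m - s) * (P ^ s) y b)) ≤
            P x y * memQ N c A (i + 1) m (insert y H) y b :=
          mul_le_mul_of_nonneg_left (by linarith) (h0 x y)
        linarith
    have := Finset.sum_le_sum fun y (_ : y ∈ Finset.univ) => key y
    rw [Finset.sum_sub_distrib, Finset.sum_add_distrib, Finset.sum_ite_mem,
      Finset.univ_inter] at this
    exact this

lemma memQ_lower2 (ht0 : ∀ B u v, 0 ≤ transPA N c B u v) (M : ℕ) (R U η : ℝ)
    (hR0 : 0 ≤ R) (hU : 0 ≤ U) (h0 : ∀ x y, 0 ≤ P x y)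
    (hη0 : 0 ≤ η) (h2 : ∀ x y, (P ^ 2) x y ≤ η)
    (ht1 : ∀ B u, u ∈ B → B.card ≤ M → ∀ v, transPA N c B u v ≤ U * P u v)
    (ht3 : ∀ B u, u ∈ B → B.card ≤ M → ∑ v, transPA N c B u v = 1)
    (A : ℕ → Finset (Vtx N)) (S : Finset (Vtx N)) (b : Vtx N) (e k : ℕ)
    (hR : ∀ (i : ℕ) (H : Finset (Vtx N)) (x : Vtx N), x ∈ H → b ∉ H → i + k = e →
      S.card + H.card + k ≤ M → R ≤ memQ N c A i k H x b)
    (n i : ℕ) (H : Finset (Vtx N)) (x : Vtx N) (hx : x ∈ H) (hb : b ∉ H)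
    (he : i + n + k = e)
    (hA : ∀ l, i ≤ l → l < e → A l ⊆ S) (hM : S.card + H.card + (n + k) ≤ M) :
    R * (1 - U * P x b - n * (U ^ 2 * η)) ≤ memQ N c A i (n + k) H x b := by
  induction n generalizing i H x with
  | zero =>
    rw [Nat.zero_add] at hM ⊢
    refine le_trans ?_ (hR i H x hx hb (by omega) hM)
    have := mul_nonneg hU (h0 x b)
    have := mul_nonneg hR0 this
    push_cast
    linarith
  | succ n ih =>
    rw [show n + 1 + k = (n + k) + 1 by ring] at hM ⊢
    rw [memQ]
    have hc := card_aux N S _ _ (hA i le_rfl (by omega)) _ _ hM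
    have hxx : x ∈ A i ∪ H := Finset.mem_union_right _ hx
    have a1 := ht3 (A i ∪ H) x hxx hc
    have a2 := ht1 (A i ∪ H) x hxx hc
    have key : ∀ y, R * (transPA N c (A i ∪ H) x y - (if y = b then U * P x y else 0)
        - U ^ 2 * (P x y * P y b) - transPA N c (A i ∪ H) x y * (n * (U ^ 2 * η))) ≤
        transPA N c (A i ∪ H) x y * memQ N c A (i + 1) (n + k) (insert y H) y b := by
      intro y
      have t0 := ht0 (A i ∪ H) x y
      have q0 := memQ_nonneg N c ht0 A (i + 1) (n + k) (insert y H) y b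
      have t1 := a2 y
      have r1 : 0 ≤ U ^ 2 * (P x y * P y b) :=
        mul_nonneg (sq_nonneg _) (mul_nonneg (h0 _ _) (h0 _ _))
      have r2 : 0 ≤ transPA N c (A i ∪ H) x y * (n * (U ^ 2 * η)) := by positivity
      split_ifs with hy
      · refine le_trans ?_ (mul_nonneg t0 q0)
        exact mul_nonpos_of_nonneg_of_nonpos hR0 (by linarith)
      · have a3 := ih (i + 1) (insert y H) y (Finset.mem_insert_self _ _)
          (by rw [Finset.mem_insert]; rintro (h | h); exacts [hy h.symm, hb h])
          (by omega) (fun l h1 h2 => hA l (by omega) (by omega)) (card_aux2 N S H y _ M hM)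
        refine le_trans ?_ (mul_le_mul_of_nonneg_left a3 t0)
        have r3 := mul_le_mul_of_nonneg_right t1 (mul_nonneg hU (h0 y b))
        have r4 := mul_le_mul_of_nonneg_left r3 hR0
        linarith
    have := Finset.sum_le_sum fun y (_ : y ∈ Finset.univ) => key y
    refine le_trans ?_ this
    rw [← Finset.mul_sum]
    refine mul_le_mul_of_nonneg_left ?_ hR0
    rw [Finset.sum_sub_distrib, Finset.sum_sub_distrib, Finset.sum_sub_distrib, a1,
      ← Finset.sum_mul, a1, ← Finset.mul_sum]
    simp only [Finset.sum_ite_eq', Finset.mem_univ, if_true]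
    have e2 : ∑ y, P x y * P y b ≤ η := by
      have := h2 x b
      rwa [pow_two, Matrix.mul_apply] at this
    have := mul_le_mul_of_nonneg_left e2 (sq_nonneg U)
    push_cast
    linarith

/-- combination, fixed N -/
lemma combine (ht0 : ∀ B u v, 0 ≤ transPA N c B u v) (M : ℕ) (U η δ θ β n e1 : ℝ)
    (hU : 0 ≤ U) (hs : ∀ x y, P x y = P y x) (h0 : ∀ x y, 0 ≤ P x y)
    (h1 : ∀ x, ∑ y, P x y = 1) (hd : ∀ u, P u u = 0)
    (hn : n = Fintype.card (Vtx N)) (hn4 : 4 ≤ n)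
    (hβ : 0 ≤ β) (hlow : ∀ u v, u ≠ v → β / n ≤ P u v)
    (hη : 1 / n ≤ η) (h2 : ∀ x y, (P ^ 2) x y ≤ η)
    (hδ : ∀ x y, P x y ≤ δ) (hηδ : η ≤ δ) (hθ0 : 0 ≤ θ)
    (hθ : ∀ F : Finset (Vtx N), F.card ≤ M → ∀ x, ∑ z ∈ F, P x z ≤ θ)
    (ht1 : ∀ B u, u ∈ B → B.card ≤ M → ∀ v, transPA N c B u v ≤ U * P u v)
    (ht2 : ∀ B u, u ∈ B → B.card ≤ M → ∀ v, v ∉ B → P u v ≤ transPA N c B u v)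
    (ht3 : ∀ B u, u ∈ B → B.card ≤ M → ∑ v, transPA N c B u v = 1)
    (A : ℕ → Finset (Vtx N)) (S : Finset (Vtx N)) (a b : Vtx N) (j k q : ℕ)
    (hkj : k ≤ j) (hk : 3 ≤ k) (hq : k = q + 2) (he1 : (1 - β / 2) ^ q * η ≤ e1)
    (hA : ∀ l, 1 ≤ l → l < 1 + j → A l ⊆ S) (hM : S.card + 1 + j ≤ M) (hbS : b ∉ S)
    (hba : b ≠ a)
    (hL : 0 ≤ 1 / n - e1 - k * (θ * η + k * (δ * η))) :
    kernelQ N c A j a b ≤ U ^ k * (1 / n + e1) ∧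
    (1 / n - e1 - k * (θ * η + k * (δ * η))) * (1 - U * δ - j * (U ^ 2 * η)) ≤
      kernelQ N c A j a b := by
  obtain ⟨r, rfl⟩ : ∃ r, j = r + k := ⟨j - k, by omega⟩
  have hη0 : 0 ≤ η := le_trans (by positivity) hη
  have hδ0 := hη0.trans hηδ
  have mix : ∀ x, |(P ^ k) x b - 1 / n| ≤ e1 := fun x => by
    rw [hq]
    exact (mixing P hs h0 h1 β n hn hn4 hβ hlow hd η h2 hη b q x).trans he1
  unfold kernelQ
  constructor
  · refine memQ_upper2 N c ht0 M _ ht3 A S b (1 + (r + k)) k ?_ r 1 {a} a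
      (Finset.mem_singleton_self a) (by omega) hA (by simpa using hM)
    intro i H x hx hik hc
    by_cases hi : 1 ≤ i
    · refine (memQ_upper N c P ht0 M U hU h0 ht1 A S b i k H x hx
        (fun l q1 q2 => hA l (by omega) (by omega)) hc).trans ?_
      refine mul_le_mul_of_nonneg_left ?_ (pow_nonneg hU _)
      have := (abs_le.1 (mix x)).2
      linarith
    · omega
  · refine le_trans (mul_le_mul_of_nonneg_left ?_ hL)
      (memQ_lower2 N c P ht0 M _ U η hL hU h0 hη0 h2 ht1 ht3 A S b (1 + (r + k)) k ?_ r 1 {a} a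
      (Finset.mem_singleton_self a) (by simpa using hba) (by omega) hA (by simpa using hM))
    · have := mul_le_mul_of_nonneg_left (hδ a b) hU
      have : (r : ℝ) * (U ^ 2 * η) ≤ ((r + k : ℕ) : ℝ) * (U ^ 2 * η) := by
        refine mul_le_mul_of_nonneg_right ?_ (by positivity)
        exact_mod_cast Nat.le_add_right r k
      linarith
    · intro i H x hx hbH hik hc
      have hi : 1 ≤ i := by omega
      have t := memQ_lower N c P ht0 M h0 ht2 (fun r => if r ≤ 1 then δ else η) (by
          intro r hr y

          split_ifs with h
          · rw [show r = 1 by omega, pow_one]; exact hδ y y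
          · exact pw_le P h0 h1 2 η h2 r (by omega) y y) (by
          intro r; split_ifs <;> assumption) A S b i k H x hx
          (fun l q1 q2 => hA l (by omega) (by omega)) hc
      have t2 := errG_le P hs h0 h1 δ η θ hδ h2 hδ0 hη0 hηδ hθ0 b k hk (S ∪ H)
        (hθ _ (by have := Finset.card_union_le S H; omega)) (by
          rw [Finset.mem_union]; rintro (h | h); exacts [hbS h, hbH h]) x
      have := (abs_le.1 (mix x)).1
      linarith
end Walk

section Geo
variable (N : ℕ) [NeZero N]

lemma rhoN_le (i : ZMod N) : 2 * rhoN N i ≤ N := by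
  have := ZMod.val_lt i
  unfold rhoN; split_ifs <;> omega

lemma rhoN_eq_zero (i : ZMod N) : rhoN N i = 0 ↔ i = 0 := by
  have := ZMod.val_lt i
  rw [← ZMod.val_eq_zero]
  unfold rhoN; split_ifs <;> omega

lemma rhoN_neg (i : ZMod N) : rhoN N (-i) = rhoN N i := by
  have := ZMod.val_lt i
  unfold rhoN
  rw [ZMod.neg_val]
  by_cases h : i = 0
  · simp [h]
  · have h' : i.val ≠ 0 := by rwa [Ne, ZMod.val_eq_zero]
    rw [if_neg h]
    split_ifs <;> omega

/-- distance to origin -/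
def r0 (z : Vtx N) : ℕ := rhoN N z.1 + rhoN N z.2

lemma dist_eq (u v : Vtx N) : torusDist N u v = r0 N (u - v) := rfl

lemma r0_le (z : Vtx N) : r0 N z ≤ N := by
  have := rhoN_le N z.1
  have := rhoN_le N z.2
  unfold r0; omega

lemma r0_eq_zero (z : Vtx N) : r0 N z = 0 ↔ z = 0 := by
  unfold r0
  rw [Nat.add_eq_zero_iff, rhoN_eq_zero, rhoN_eq_zero, Prod.ext_iff]
  rfl

lemma r0_neg (z : Vtx N) : r0 N (-z) = r0 N z := by
  unfold r0
  rw [Prod.fst_neg, Prod.snd_neg, rhoN_neg, rhoN_neg]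

lemma dist_symm (u v : Vtx N) : torusDist N u v = torusDist N v u := by
  rw [dist_eq, dist_eq, ← r0_neg, neg_sub]

lemma sum_dist (f : ℕ → ℝ) (u : Vtx N) :
    ∑ v, f (torusDist N u v) = ∑ z, f (r0 N z) := by
  simp_rw [dist_eq]
  exact Equiv.sum_comp (Equiv.subLeft u) (fun z => f (r0 N z))

lemma card_r0 (r : ℕ) (hr : 1 ≤ r) :
    (Finset.univ.filter (fun z : Vtx N => r0 N z = r)).card ≤ 8 * r := by
  have : (Finset.univ.filter (fun z : Vtx N => r0 N z = r)).card ≤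
      ((Finset.univ : Finset Bool) ×ˢ (Finset.univ : Finset Bool) ×ˢ
        Finset.range (r + 1)).card := by
    refine Finset.card_le_card_of_injOn
      (fun z => (decide (2 * z.1.val ≤ N), decide (2 * z.2.val ≤ N), rhoN N z.1)) ?_ ?_
    · intro z hz
      have hz' : r0 N z = r := by simpa using hz
      unfold r0 at hz'
      simp
      omega
    · intro z hz z' hz' h
      have e1 : r0 N z = r := by simpa using hz
      have e2 : r0 N z' = r := by simpa using hz'
      simp only [Prod.mk.injEq, decide_eq_decide] at h
      obtain ⟨h1, h2, h3⟩ := h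
      have l1 := ZMod.val_lt z.1
      have l2 := ZMod.val_lt z.2
      have l3 := ZMod.val_lt z'.1
      have l4 := ZMod.val_lt z'.2
      have h4 : rhoN N z.2 = rhoN N z'.2 := by unfold r0 at e1 e2; omega
      refine Prod.ext (ZMod.val_injective N ?_) (ZMod.val_injective N ?_)
      · unfold rhoN at h3
        split_ifs at h3 <;> omega
      · unfold rhoN at h4
        split_ifs at h4 <;> omega
  refine this.trans ?_
  simp [Finset.card_product]
  omega

lemma sum_r0_le (f : ℕ → ℝ) (hf : ∀ r, 0 ≤ f r) (hf0 : f 0 = 0) :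
    ∑ z, f (r0 N z) ≤ ∑ r ∈ Finset.range N, 8 * ((r : ℝ) + 1) * f (r + 1) := by
  have e : ∑ z, f (r0 N z) = ∑ r ∈ Finset.range (N + 1),
      ∑ z ∈ Finset.univ.filter (fun z : Vtx N => r0 N z = r), f (r0 N z) :=
    (Finset.sum_fiberwise_of_maps_to (fun z _ => by
      rw [Finset.mem_range]; have := r0_le N z; omega) _).symm
  rw [e, Finset.sum_range_succ']
  have z0 : ∑ z ∈ Finset.univ.filter (fun z : Vtx N => r0 N z = 0), f (r0 N z) = 0 := by
    refine Finset.sum_eq_zero fun z hz => ?_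
    rw [(Finset.mem_filter.1 hz).2, hf0]
  rw [z0, add_zero]
  refine Finset.sum_le_sum fun r _ => ?_
  calc _ = ∑ z ∈ Finset.univ.filter (fun z : Vtx N => r0 N z = r + 1), f (r + 1) :=
        Finset.sum_congr rfl fun z hz => by rw [(Finset.mem_filter.1 hz).2]
    _ = ((Finset.univ.filter (fun z : Vtx N => r0 N z = r + 1)).card : ℝ) * f (r + 1) := by
        simp
    _ ≤ _ := by
        refine mul_le_mul_of_nonneg_right ?_ (hf _)
        exact_mod_cast card_r0 N (r + 1) (by omega)

/-- sum of inverse distances -/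
noncomputable def S1 : ℝ := ∑ z : Vtx N, ((r0 N z : ℕ) : ℝ)⁻¹

lemma S1_le : S1 N ≤ 8 * N := by
  refine (sum_r0_le N (fun r => (r : ℝ)⁻¹) (fun r => by positivity) (by simp)).trans ?_
  have : ∀ r ∈ Finset.range N, 8 * ((r : ℝ) + 1) * (((r + 1 : ℕ) : ℝ))⁻¹ = 8 := by
    intro r _
    push_cast
    field_simp
  rw [Finset.sum_congr rfl this]
  simp; linarith

lemma S2_le : ∑ z : Vtx N, (((r0 N z : ℕ) : ℝ)⁻¹) ^ 2 ≤ 8 * (1 + Real.log N) := by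
  refine (sum_r0_le N (fun r => ((r : ℝ)⁻¹) ^ 2) (fun r => by positivity) (by simp)).trans ?_
  have : ∀ r ∈ Finset.range N, 8 * ((r : ℝ) + 1) * ((((r + 1 : ℕ) : ℝ))⁻¹) ^ 2 =
      8 * (((r + 1 : ℕ) : ℝ))⁻¹ := by
    intro r _
    push_cast
    field_simp
  rw [Finset.sum_congr rfl this, ← Finset.mul_sum]
  have := harmonic_le_one_add_log N
  unfold harmonic at this
  push_cast at this ⊢
  linarith

lemma S1_ge (hN : 2 ≤ N) : (N : ℝ) / 2 ≤ S1 N := by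
  have h : ∀ z ∈ (Finset.univ : Finset (Vtx N)).erase 0, (N : ℝ)⁻¹ ≤ ((r0 N z : ℕ) : ℝ)⁻¹ := by
    intro z hz
    have h1 : r0 N z ≠ 0 := by rw [Ne, r0_eq_zero]; exact (Finset.mem_erase.1 hz).1
    have h2 := r0_le N z
    have h3 : (0 : ℝ) < r0 N z := by exact_mod_cast Nat.pos_of_ne_zero h1
    exact inv_anti₀ h3 (by exact_mod_cast h2)
  have h1 : ∑ z ∈ (Finset.univ : Finset (Vtx N)).erase 0, (N : ℝ)⁻¹ ≤ S1 N :=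
    (Finset.sum_le_sum h).trans
      (Finset.sum_le_sum_of_subset_of_nonneg (Finset.erase_subset _ _)
        fun z _ _ => by positivity)
  refine le_trans ?_ h1
  have hN' : (2 : ℝ) ≤ N := by exact_mod_cast hN
  have hc : (((Finset.univ : Finset (Vtx N)).erase 0).card : ℝ) = (N : ℝ) * N - 1 := by
    rw [Finset.card_erase_of_mem (Finset.mem_univ _), Finset.card_univ, Fintype.card_prod,
      ZMod.card, Nat.cast_sub (by nlinarith)]
    push_cast; ring
  rw [Finset.sum_const, nsmul_eq_mul, hc, ← div_eq_mul_inv, div_le_div_iff₀ (by norm_num) (by linarith)]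
  nlinarith

/-- the free kernel -/
noncomputable def PP : Matrix (Vtx N) (Vtx N) ℝ :=
  fun u v => ((torusDist N u v : ℕ) : ℝ)⁻¹ / S1 N

lemma PP_symm (u v : Vtx N) : PP N u v = PP N v u := by
  unfold PP; rw [dist_symm]

lemma S1_pos (hN : 2 ≤ N) : 0 < S1 N := by
  have := S1_ge N hN
  have hN' : (2 : ℝ) ≤ N := by exact_mod_cast hN
  linarith

lemma PP_nonneg (u v : Vtx N) : 0 ≤ PP N u v := by
  unfold PP S1; positivity

lemma PP_row (hN : 2 ≤ N) (u : Vtx N) : ∑ v, PP N u v = 1 := by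
  unfold PP
  rw [← Finset.sum_div, sum_dist N (fun r => (r : ℝ)⁻¹)]
  exact div_self (S1_pos N hN).ne'

lemma PP_diag (u : Vtx N) : PP N u u = 0 := by
  unfold PP
  rw [dist_eq, sub_self, (r0_eq_zero N 0).2 rfl]; simp

lemma PP_low (hN : 2 ≤ N) (u v : Vtx N) (h : u ≠ v) :
    (1 / 8) / ((N : ℝ) ^ 2) ≤ PP N u v := by
  unfold PP
  have h1 : torusDist N u v ≠ 0 := by
    rw [dist_eq, Ne, r0_eq_zero, sub_eq_zero]; exact h
  have h2 : torusDist N u v ≤ N := by rw [dist_eq]; exact r0_le N _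
  have h3 : (0 : ℝ) < torusDist N u v := by exact_mod_cast Nat.pos_of_ne_zero h1
  have h4 : (torusDist N u v : ℝ) ≤ N := by exact_mod_cast h2
  have h5 := S1_le N
  have h6 := S1_pos N hN
  have h7 : (0 : ℝ) < N := by linarith
  rw [inv_eq_one_div, div_div, div_div, div_le_div_iff₀ (by positivity) (by positivity)]
  nlinarith [mul_le_mul h4 h5 h6.le h7.le]

lemma PP_le_inv (hN : 2 ≤ N) (u v : Vtx N) :
    PP N u v ≤ 2 / N * ((torusDist N u v : ℕ) : ℝ)⁻¹ := by
  unfold PP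
  have h6 := S1_pos N hN
  have h5 := S1_ge N hN
  have h7 : (0 : ℝ) < N := by exact_mod_cast (by omega : 0 < N)
  rw [div_eq_mul_inv, mul_comm]
  refine mul_le_mul_of_nonneg_right ?_ (by positivity)
  rw [inv_eq_one_div, div_le_div_iff₀ h6 h7]
  linarith

lemma PP_le (hN : 2 ≤ N) (u v : Vtx N) : PP N u v ≤ 2 / N := by
  refine (PP_le_inv N hN u v).trans ?_
  have h7 : (0 : ℝ) < N := by exact_mod_cast (by omega : 0 < N)
  have : ((torusDist N u v : ℕ) : ℝ)⁻¹ ≤ 1 := Nat.cast_inv_le_one _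
  calc _ ≤ 2 / (N : ℝ) * 1 := mul_le_mul_of_nonneg_left this (by positivity)
    _ = _ := mul_one _

lemma PP_sq (hN : 2 ≤ N) (u v : Vtx N) :
    (PP N ^ 2) u v ≤ 32 * (1 + Real.log N) / (N : ℝ) ^ 2 := by
  have h7 : (0 : ℝ) < N := by exact_mod_cast (by omega : 0 < N)
  rw [pow_two, Matrix.mul_apply]
  have key : ∀ w, PP N u w * PP N w v ≤ (2 / N) ^ 2 *
      (((((torusDist N u w : ℕ) : ℝ)⁻¹) ^ 2 + (((torusDist N v w : ℕ) : ℝ)⁻¹) ^ 2) / 2) := by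
    intro w
    have a1 := PP_le_inv N hN u w
    have a2 := PP_le_inv N hN v w
    rw [PP_symm N w v]
    have := mul_le_mul a1 a2 (PP_nonneg N _ _) (by positivity)
    refine this.trans ?_
    set p := ((torusDist N u w : ℕ) : ℝ)⁻¹
    set q := ((torusDist N v w : ℕ) : ℝ)⁻¹
    have : (2 / (N : ℝ)) ^ 2 * (p * q) ≤ (2 / N) ^ 2 * ((p ^ 2 + q ^ 2) / 2) :=
      mul_le_mul_of_nonneg_left (by nlinarith [sq_nonneg (p - q)]) (by positivity)
    linarith
  refine (Finset.sum_le_sum fun w _ => key w).trans ?_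
  rw [← Finset.mul_sum, ← Finset.sum_div, Finset.sum_add_distrib,
    sum_dist N (fun r => ((r : ℝ)⁻¹) ^ 2), sum_dist N (fun r => ((r : ℝ)⁻¹) ^ 2)]
  have := S2_le N
  calc _ ≤ (2 / (N : ℝ)) ^ 2 * (8 * (1 + Real.log N)) :=
        mul_le_mul_of_nonneg_left (by linarith) (by positivity)
    _ = _ := by field_simp; ring

lemma PP_set (hN : 2 ≤ N) (t : ℝ) (ht : 0 < t) (F : Finset (Vtx N)) (u : Vtx N) :
    ∑ v ∈ F, PP N u v ≤ 2 / N * (t * (8 * (1 + Real.log N)) + F.card / t) := by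
  have h7 : (0 : ℝ) < N := by exact_mod_cast (by omega : 0 < N)
  have key : ∀ v ∈ F, PP N u v ≤ 2 / N *
      (t * (((torusDist N u v : ℕ) : ℝ)⁻¹) ^ 2 + 1 / t) := by
    intro v _
    refine (PP_le_inv N hN u v).trans (mul_le_mul_of_nonneg_left ?_ (by positivity))
    set p := ((torusDist N u v : ℕ) : ℝ)⁻¹
    have : t * p ^ 2 + 1 / t - p = ((t * p - 1) ^ 2 + t * p) / t := by field_simp; ring
    have hp : 0 ≤ p := by positivity
    have : 0 ≤ ((t * p - 1) ^ 2 + t * p) / t := by positivity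
    linarith
  refine (Finset.sum_le_sum key).trans ?_
  rw [← Finset.mul_sum, Finset.sum_add_distrib, ← Finset.mul_sum]
  refine mul_le_mul_of_nonneg_left ?_ (by positivity)
  have h1 : ∑ v ∈ F, (((torusDist N u v : ℕ) : ℝ)⁻¹) ^ 2 ≤ 8 * (1 + Real.log N) := by
    refine le_trans ?_ (S2_le N)
    rw [← sum_dist N (fun r => ((r : ℝ)⁻¹) ^ 2) u]
    exact Finset.sum_le_sum_of_subset_of_nonneg (Finset.subset_univ _)
      fun z _ _ => by positivity
  have h2 : ∑ v ∈ F, 1 / t = F.card / t := by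
    rw [Finset.sum_const, nsmul_eq_mul]; ring
  rw [h2]
  have := mul_le_mul_of_nonneg_left h1 ht.le
  linarith

variable (c : ℝ)

lemma edge_eq (hN : 2 ≤ N) (hc0 : 0 < c) (hc1 : c ≤ 1) (u v : Vtx N) :
    edgeProb N c u v = (c / N * S1 N) * PP N u v := by
  have h6 := S1_pos N hN
  unfold edgeProb
  split_ifs with h
  · subst h; rw [PP_diag]; simp
  · have h7 : (1 : ℝ) ≤ N := by exact_mod_cast (by omega : 1 ≤ N)
    have h1 : torusDist N u v ≠ 0 := by
      rw [dist_eq, Ne, r0_eq_zero, sub_eq_zero]; exact h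
    have h3 : (1 : ℝ) ≤ torusDist N u v := by exact_mod_cast Nat.pos_of_ne_zero h1
    rw [min_eq_left]
    · unfold PP; field_simp
    · rw [div_le_one (by positivity)]; nlinarith

lemma trans_nonneg (hN : 2 ≤ N) (hc0 : 0 < c) (hc1 : c ≤ 1) (B : Finset (Vtx N))
    (u v : Vtx N) : 0 ≤ transPA N c B u v := by
  have e0 : ∀ v, 0 ≤ edgeProb N c u v := fun v => by
    rw [edge_eq N c hN hc0 hc1]
    have := S1_pos N hN
    have := PP_nonneg N u v
    positivity
  unfold transPA ZNA
  split_ifs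
  · exact le_rfl
  · exact div_nonneg (e0 v) (Finset.sum_nonneg fun v _ => e0 v)

lemma trans_eq (hN : 2 ≤ N) (hc0 : 0 < c) (hc1 : c ≤ 1) (B : Finset (Vtx N))
    (u v : Vtx N) (hu : u ∈ B) : transPA N c B u v =
      if v ∈ B then 0 else PP N u v / (1 - ∑ w ∈ B, PP N u w) := by
  have h6 := S1_pos N hN
  have h7 : (0 : ℝ) < N := by exact_mod_cast (by omega : 0 < N)
  unfold transPA ZNA
  split_ifs with h
  · rfl
  · rw [Finset.erase_eq_of_notMem (by simp [hu])]
    simp_rw [edge_eq N c hN hc0 hc1]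
    rw [← Finset.mul_sum, mul_div_mul_left _ _ (by positivity), ← PP_row N hN u,
      ← Finset.sum_sdiff (Finset.subset_univ B), add_sub_cancel_right]

lemma trans_facts (hN : 2 ≤ N) (hc0 : 0 < c) (hc1 : c ≤ 1) (M : ℕ) (θ : ℝ) (hθ1 : θ < 1)
    (hθ : ∀ F : Finset (Vtx N), F.card ≤ M → ∀ x, ∑ z ∈ F, PP N x z ≤ θ) :
    (∀ B u, u ∈ B → B.card ≤ M → ∀ v, transPA N c B u v ≤ (1 - θ)⁻¹ * PP N u v) ∧
    (∀ B u, u ∈ B → B.card ≤ M → ∀ v, v ∉ B → PP N u v ≤ transPA N c B u v) ∧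
    (∀ B u, u ∈ B → B.card ≤ M → ∑ v, transPA N c B u v = 1) := by
  refine ⟨?_, ?_, ?_⟩
  · intro B u hu hB v
    rw [trans_eq N c hN hc0 hc1 B u v hu]
    have := hθ B hB u
    have hp := PP_nonneg N u v
    have h1 : 0 < 1 - θ := by linarith
    split_ifs
    · positivity
    · rw [div_eq_mul_inv, mul_comm]
      exact mul_le_mul_of_nonneg_right (inv_anti₀ h1 (by linarith)) hp
  · intro B u hu hB v hv
    rw [trans_eq N c hN hc0 hc1 B u v hu, if_neg hv]
    have := hθ B hB u
    have hp := PP_nonneg N u v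
    have h0 : 0 ≤ ∑ w ∈ B, PP N u w := Finset.sum_nonneg fun w _ => PP_nonneg N u w
    rw [le_div_iff₀ (by linarith)]
    nlinarith
  · intro B u hu hB
    have := hθ B hB u
    have : 0 < 1 - ∑ w ∈ B, PP N u w := by linarith
    have z0 : ∑ v ∈ B, transPA N c B u v = 0 := Finset.sum_eq_zero fun v hv => by
      rw [trans_eq N c hN hc0 hc1 B u _ hu, if_pos hv]
    have z1 : ∑ v ∈ Finset.univ \ B, transPA N c B u v =
        ∑ v ∈ Finset.univ \ B, PP N u v / (1 - ∑ w ∈ B, PP N u w) :=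
      Finset.sum_congr rfl fun v hv => by
        rw [trans_eq N c hN hc0 hc1 B u _ hu, if_neg (Finset.mem_sdiff.1 hv).2]
    rw [← Finset.sum_sdiff (Finset.subset_univ B), z0, add_zero, z1,
      ← Finset.sum_div, div_eq_one_iff_eq this.ne', eq_sub_iff_add_eq,
      Finset.sum_sdiff (Finset.subset_univ B)]
    exact PP_row N hN u
end Geo

lemma poly_exp (n : ℕ) (b D e : ℝ) (hb : 0 < b) (he : 0 < e) :
    ∀ᶠ x : ℝ in Filter.atTop, D * ((1 + x) ^ n * Real.exp (-b * x)) ≤ e := by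
  have h := tendsto_rpow_mul_exp_neg_mul_atTop_nhds_zero n b hb
  have h1 : Filter.Tendsto (fun x : ℝ => 1 + x) Filter.atTop Filter.atTop :=
    Filter.tendsto_atTop_add_const_left _ _ Filter.tendsto_id
  have h2 := (h.comp h1).const_mul (D * Real.exp b)
  rw [mul_zero] at h2
  filter_upwards [h2.eventually_le_const he] with x hx
  refine le_trans (le_of_eq ?_) hx
  simp only [Function.comp, Real.rpow_natCast]
  rw [show -b * (1 + x) = -b + -b * x by ring, Real.exp_add, Real.exp_neg]
  field_simp

lemma aux_kD {k C x D y : ℝ} (h : k < C * x + 1) (hC : 0 ≤ C) (hx : 0 ≤ x) (hD : D = C + 1)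
    (hy : y = 1 + x) : k ≤ D * y := by
  subst hD hy; linarith

lemma aux_8 {D K : ℝ} (hD : 1 ≤ D) (hK : 0 ≤ K) : 8 ≤ D * (8 + K) := by nlinarith

lemma aux_g {k C x q g : ℝ} (h1 : C * x ≤ k) (h2 : k = q + 2) (hg : 0 ≤ g) :
    q * -g ≤ 2 * g + -(g * C) * x := by
  subst h2; nlinarith

lemma aux_4 {n : ℝ} (h : 2 ≤ n) : 4 ≤ n ^ 2 := by nlinarith

lemma aux_u {e f : ℝ} (h1 : 0 < e) (h2 : 0 < f) (h3 : f ≤ 1 / 4) (h4 : f ≤ e / 4) :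
    (1 - f)⁻¹ * (1 + f) ≤ 1 + e := by
  rw [inv_mul_le_iff₀ (by linarith)]; nlinarith

lemma ccr_pos : 0 < ccr := by
  unfold ccr
  have := Real.log_two_gt_d9
  positivity

lemma ccr_lt : ccr < 1 := by
  unfold ccr
  have := Real.log_two_gt_d9
  rw [div_lt_one (by linarith)]
  linarith

set_option maxHeartbeats 1000000 in
/-- Let `c = c^cr` and `C₀ = −6/log(1 − c/2)`. For all `T > 0`, `K > 0` and every
`ε > 0` there is `N₀` such that for every `N ≥ N₀`, every `j` with
`C₀·log N < j ≤ T·N^{4/3}`, every nondecreasing sequence `𝐀 = (A₁ ⊆ … ⊆ A_j)` with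
`|A_j| ≤ K·N^{4/3}`, every `a ∈ V_N` and every `b ∈ V_N ∖ (A_j ∪ {a})`:
`|N²·Q(𝐀,j;a,b) − 1| ≤ ε`; that is, the self-avoiding walk with memory is
asymptotically uniformly distributed on `V_N`. -/
theorem stmt18 (T : ℝ) (hT : 0 < T) (K : ℝ) (hK : 0 < K) (ε : ℝ) (hε : 0 < ε) :
    ∃ N₀ : ℕ, ∀ (N : ℕ) [NeZero N], N₀ ≤ N →
      ∀ j : ℕ, -6 / Real.log (1 - ccr / 2) * Real.log N < (j : ℝ) →
        (j : ℝ) ≤ T * (N : ℝ) ^ ((4 : ℝ) / 3) →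
        ∀ A : ℕ → Finset (Vtx N),
          (∀ i i' : ℕ, 1 ≤ i → i ≤ i' → i' ≤ j → A i ⊆ A i') →
          ((A j).card : ℝ) ≤ K * (N : ℝ) ^ ((4 : ℝ) / 3) →
          ∀ a b : Vtx N, b ∉ A j → b ≠ a →
            |(N : ℝ) ^ 2 * kernelQ N ccr A j a b - 1| ≤ ε := by
  
  have hc0 := ccr_pos
  have hc1 := ccr_lt
  set C₀ : ℝ := -6 / Real.log (1 - ccr / 2) with hC₀
  have hC : 0 < C₀ := by
    have : Real.log (1 - ccr / 2) < 0 := Real.log_neg (by linarith) (by linarith)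
    exact div_pos_of_neg_of_neg (by norm_num) this
  obtain ⟨g, hg⟩ : ∃ g, g = -Real.log (15 / 16) := ⟨_, rfl⟩
  have hg0 : 0 < g := by
    rw [hg]; have := Real.log_neg (x := 15 / 16) (by norm_num) (by norm_num); linarith
  obtain ⟨ε', hε'⟩ : ∃ e, e = min ε 1 / 4 := ⟨_, rfl⟩
  have hε'0 : 0 < ε' := by rw [hε']; have := lt_min hε one_pos; linarith
  have hε'1 : ε' ≤ 1 / 4 := by rw [hε']; have := min_le_right ε 1; linarith
  have hε'2 : ε' ≤ ε / 4 := by rw [hε']; have := min_le_left ε 1; linarith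
  obtain ⟨K', hK'⟩ : ∃ x, x = K + T + 1 := ⟨_, rfl⟩
  obtain ⟨D1, hD1⟩ : ∃ x, x = C₀ + 1 := ⟨_, rfl⟩
  obtain ⟨D, hD⟩ : ∃ x, x = 64 * D1 * (8 + K') + 64 * D1 ^ 2 + 4 + 128 * T := ⟨_, rfl⟩
  have ev1 := poly_exp 3 (1 / 3) D ε' (by norm_num) hε'0
  have ev2 := poly_exp 1 (g * C₀) (32 * Real.exp (2 * g)) ε' (by positivity) hε'0
  have ev3 := Filter.eventually_ge_atTop (3 / C₀ : ℝ)
  have lim : Filter.Tendsto (fun N : ℕ => Real.log (N : ℝ)) Filter.atTop Filter.atTop :=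
    Real.tendsto_log_atTop.comp tendsto_natCast_atTop_atTop
  obtain ⟨N₀, hN₀⟩ := Filter.eventually_atTop.1
    ((lim.eventually (ev1.and (ev2.and ev3))).and (Filter.eventually_ge_atTop 2))
  refine ⟨N₀, ?_⟩
  intro N _ hNN j hj1 hj2 A hA hAj a b hb hba
  obtain ⟨⟨q1, q2, q3⟩, hN⟩ := hN₀ N hNN
  have hNr : (2 : ℝ) ≤ N := by exact_mod_cast hN
  have hNp : (0 : ℝ) < N := by linarith
  obtain ⟨x, hx⟩ : ∃ x, x = Real.log N := ⟨_, rfl⟩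
  rw [← hx] at q1 q2 q3 hj1
  have hx0 : 0 ≤ x := by rw [hx]; exact Real.log_nonneg (by linarith)
  have hNx : (N : ℝ) = Real.exp x := by rw [hx, Real.exp_log hNp]
  obtain ⟨y, hy⟩ : ∃ y, y = 1 + x := ⟨_, rfl⟩
  have hy1 : 1 ≤ y := by linarith
  rw [← hy] at q1 q2
  obtain ⟨E, hE⟩ : ∃ E, E = Real.exp (-(1 / 3) * x) := ⟨_, rfl⟩
  have hE0 : 0 < E := by rw [hE]; exact Real.exp_pos _
  have hE1 : E ≤ 1 := by rw [hE]; exact Real.exp_le_one_iff.2 (by linarith)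
  rw [← hE] at q1
  have hNE : (N : ℝ) * E ^ 3 = 1 := by
    rw [hNx, hE, ← Real.exp_nat_mul, ← Real.exp_add]
    norm_num; ring_nf
  have hN43 : (N : ℝ) ^ ((4 : ℝ) / 3) * E ^ 4 = 1 := by
    rw [hNx, hE, ← Real.exp_mul, ← Real.exp_nat_mul, ← Real.exp_add]
    norm_num; ring_nf
  have hN43' : (N : ℝ) ^ ((4 : ℝ) / 3) = 1 / E ^ 4 := by
    rw [eq_div_iff (by positivity)]; exact hN43
  have hNinv : (N : ℝ) = 1 / E ^ 3 := by
    rw [eq_div_iff (by positivity)]; exact hNE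
  clear_value C₀
  -- k
  obtain ⟨k, hk⟩ : ∃ k, k = ⌈C₀ * x⌉₊ := ⟨_, rfl⟩
  have hk1 : C₀ * x ≤ k := by rw [hk]; exact Nat.le_ceil _
  have hk2 : (k : ℝ) < C₀ * x + 1 := by rw [hk]; exact Nat.ceil_lt_add_one (by positivity)
  have hkj : k ≤ j := by rw [hk]; exact Nat.ceil_le.2 hj1.le
  have hk3 : 3 ≤ k := by
    have : (3 : ℝ) ≤ k := by
      rw [div_le_iff₀ hC] at q3; linarith
    exact_mod_cast this
  have hkD : (k : ℝ) ≤ D1 * y := by exact aux_kD hk2 hC.le hx0 hD1 hy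
  have hK'0 : 0 < K' := by linarith
  have hD10 : 1 ≤ D1 := by linarith
  -- M and theta
  obtain ⟨M, hM⟩ : ∃ M, M = (A j).card + 1 + j := ⟨_, rfl⟩
  have hMr : (M : ℝ) ≤ K' / E ^ 4 := by
    have h1 : (1 : ℝ) ≤ 1 / E ^ 4 := by
      rw [le_div_iff₀ (by positivity), one_mul]; exact pow_le_one₀ hE0.le hE1
    rw [hN43'] at hAj hj2
    rw [hM, hK']; push_cast
    have : (K + T + 1) / E ^ 4 = K * (1 / E ^ 4) + T * (1 / E ^ 4) + 1 / E ^ 4 := by ring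
    linarith
  obtain ⟨θ, hθd⟩ : ∃ θ, θ = 2 * (8 + K') * y * E := ⟨_, rfl⟩
  have hθ0 : 0 ≤ θ := by rw [hθd]; positivity
  have hθ : ∀ F : Finset (Vtx N), F.card ≤ M → ∀ x, ∑ z ∈ F, PP N x z ≤ θ := by
    intro F hF u
    refine (PP_set N hN (1 / E ^ 2) (by positivity) F u).trans ?_
    have hFr : (F.card : ℝ) ≤ K' / E ^ 4 := le_trans (by exact_mod_cast hF) hMr
    rw [← hx, ← hy]
    have h1 : (F.card : ℝ) / (1 / E ^ 2) ≤ K' * y / E ^ 2 := by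
      calc (F.card : ℝ) / (1 / E ^ 2) = F.card * E ^ 2 := by rw [one_div, div_inv_eq_mul]
        _ ≤ K' / E ^ 4 * E ^ 2 := by gcongr
        _ = K' * 1 / E ^ 2 := by field_simp
        _ ≤ _ := by gcongr
    calc _ ≤ 2 / (N : ℝ) * (1 / E ^ 2 * (8 * y) + K' * y / E ^ 2) := by gcongr
      _ = θ := by rw [hNinv, hθd]; field_simp
  have hE2 : E ^ 2 ≤ E := pow_le_of_le_one hE0.le hE1 two_ne_zero
  have hE3 : E ^ 3 ≤ E := pow_le_of_le_one hE0.le hE1 three_ne_zero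
  obtain ⟨W, hW⟩ : ∃ W, W = y ^ 3 * E := ⟨_, rfl⟩
  rw [← hW] at q1
  have hy2 : y ≤ y ^ 2 := le_self_pow₀ hy1 two_ne_zero
  have hy3 : y ^ 2 ≤ y ^ 3 := pow_le_pow_right₀ hy1 (by norm_num)
  have hkθ : k * θ ≤ 2 * D1 * (8 + K') * (y ^ 2 * E) := by
    calc (k : ℝ) * θ ≤ D1 * y * θ := by gcongr
      _ = _ := by rw [hθd]; ring
  have hyEW : y * E ≤ W := by rw [hW]; gcongr; linarith
  have hy2EW : y ^ 2 * E ≤ W := by rw [hW]; gcongr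
  have hEW : E ≤ W := (le_mul_of_one_le_left hE0.le hy1).trans hyEW
  have hW0 : 0 < W := by linarith
  have hDW : D * W = 64 * (D1 * (8 + K') * W) + 64 * (D1 ^ 2 * W) + 4 * W + 128 * (T * W) := by
    rw [hD]; ring
  have p1 : 0 ≤ D1 * (8 + K') * W := by positivity
  have p2 : 0 ≤ D1 ^ 2 * W := by positivity
  have p3 : 0 ≤ T * W := by positivity
  have p4 : D1 * (8 + K') * (y ^ 2 * E) ≤ D1 * (8 + K') * W := by gcongr
  have p5 : 8 * W ≤ D1 * (8 + K') * W := by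
    have : 8 ≤ D1 * (8 + K') := aux_8 hD10 hK'0.le
    gcongr
  have hkθε : k * θ ≤ ε' := by linarith
  have hθk : θ ≤ k * θ := by
    have : (1 : ℝ) ≤ k := by exact_mod_cast (by omega : 1 ≤ k)
    exact le_mul_of_one_le_left hθ0 this
  have hθ4 : θ ≤ 1 / 4 := by linarith
  obtain ⟨U, hU⟩ : ∃ U, U = (1 - θ)⁻¹ := ⟨_, rfl⟩
  have hU0 : 0 ≤ U := by rw [hU, inv_nonneg]; linarith
  have hU2 : U ≤ 2 := by
    rw [hU, inv_le_comm₀ (by linarith) (by norm_num)]; linarith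
  have hUk : U ^ k ≤ (1 - ε')⁻¹ := by
    rw [hU, inv_pow]
    refine inv_anti₀ (by linarith) ?_
    have := one_add_mul_le_pow (a := -θ) (by linarith) k
    rw [← sub_eq_add_neg] at this
    linarith
  obtain ⟨f1, f2, f3⟩ := trans_facts N ccr hN hc0 hc1.le M θ (by linarith) hθ
  rw [← hU] at f1
  obtain ⟨η, hη⟩ : ∃ η, η = 32 * y / (N : ℝ) ^ 2 := ⟨_, rfl⟩
  have hη0 : 0 ≤ η := by rw [hη]; positivity
  have hnη : (N : ℝ) ^ 2 * η = 32 * y := by rw [hη]; field_simp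
  obtain ⟨q, hq⟩ : ∃ q, k = q + 2 := ⟨k - 2, by omega⟩
  obtain ⟨e1, he1⟩ : ∃ e1, e1 = (1 - (1 / 8 : ℝ) / 2) ^ q * η := ⟨_, rfl⟩
  have hne1 : (N : ℝ) ^ 2 * e1 ≤ ε' := by
    refine le_trans ?_ q2
    have : (1 - (1 / 8 : ℝ) / 2) ^ q ≤ Real.exp (2 * g) * Real.exp (-(g * C₀) * x) := by
      rw [show (1 - (1 / 8 : ℝ) / 2) = Real.exp (-g) by
        rw [hg, neg_neg, Real.exp_log (by norm_num)]; norm_num,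
        ← Real.exp_nat_mul, ← Real.exp_add]
      apply Real.exp_le_exp.2
      have : (k : ℝ) = q + 2 := by rw [hq]; push_cast; ring
      exact aux_g hk1 this hg0.le
    calc (N : ℝ) ^ 2 * e1 = (1 - (1 / 8 : ℝ) / 2) ^ q * ((N : ℝ) ^ 2 * η) := by rw [he1]; ring
      _ = (1 - (1 / 8 : ℝ) / 2) ^ q * (32 * y) := by rw [hnη]
      _ ≤ Real.exp (2 * g) * Real.exp (-(g * C₀) * x) * (32 * y) := by gcongr
      _ = _ := by ring
  obtain ⟨e2, he2⟩ : ∃ e2, e2 = k * (θ * η + k * (2 / N * η)) := ⟨_, rfl⟩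
  have hne2 : (N : ℝ) ^ 2 * e2 ≤ ε' := by
    have r1 : (N : ℝ) ^ 2 * e2 = 32 * (y * (k * θ)) + 64 * (y * (k ^ 2 * E ^ 3)) := by
      calc (N : ℝ) ^ 2 * e2 = k * (θ + k * (2 / N)) * ((N : ℝ) ^ 2 * η) := by rw [he2]; ring
        _ = k * (θ + k * (2 / N)) * (32 * y) := by rw [hnη]
        _ = _ := by
          rw [show 2 / (N : ℝ) = 2 * E ^ 3 by rw [hNinv]; field_simp]; ring
    have r2 : y * (k * θ) ≤ 2 * (D1 * (8 + K') * W) := by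
      calc y * (k * θ) ≤ y * (2 * D1 * (8 + K') * (y ^ 2 * E)) := by gcongr
        _ = _ := by rw [hW]; ring
    have r3 : y * (k ^ 2 * E ^ 3) ≤ D1 ^ 2 * W := by
      calc y * ((k : ℝ) ^ 2 * E ^ 3) ≤ y * ((D1 * y) ^ 2 * E) := by gcongr
        _ = _ := by rw [hW]; ring
    rw [r1]; linarith
  have hn4 : (4 : ℝ) ≤ (N : ℝ) ^ 2 := aux_4 hNr
  have hn0 : (0 : ℝ) < (N : ℝ) ^ 2 := by positivity
  have hηδ : η ≤ 2 / N := by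
    have h1 : (N : ℝ) * η = 32 * (y * E ^ 3) := by
      rw [hη, hNinv]; field_simp
    have h2 : y * E ^ 3 ≤ W := le_trans (by gcongr) hyEW
    rw [le_div_iff₀ hNp]
    linarith
  have hL : 0 ≤ 1 / (N : ℝ) ^ 2 - e1 - e2 := by
    have : 0 ≤ (N : ℝ) ^ 2 * (1 / (N : ℝ) ^ 2 - e1 - e2) := by
      rw [mul_sub, mul_sub, mul_one_div_cancel hn0.ne']; linarith
    exact nonneg_of_mul_nonneg_right this hn0
  have main := combine N ccr (PP N) (fun B u v => trans_nonneg N ccr hN hc0 hc1.le B u v) M U η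
    (2 / N) θ (1 / 8) ((N : ℝ) ^ 2) e1 hU0 (PP_symm N) (PP_nonneg N) (PP_row N hN) (PP_diag N)
    (by rw [Fintype.card_prod, ZMod.card]; push_cast; ring) hn4 (by norm_num) (PP_low N hN)
    (by rw [hη]; gcongr; linarith)
    (fun u v => by rw [hη, hy, hx]; exact PP_sq N hN u v) (PP_le N hN) hηδ hθ0 hθ f1 f2 f3
    A (A j) a b j k q hkj hk3 hq he1.ge (fun l h1 h2 => hA l j h1 (by omega) le_rfl)
    hM.ge hb hba (by rw [← he2]; exact hL)
  rw [← he2] at main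
  obtain ⟨m1, m2⟩ := main
  have hne1' : 0 ≤ (N : ℝ) ^ 2 * e1 := by rw [he1]; positivity
  have he3 : U * (2 / N) + j * (U ^ 2 * η) ≤ ε' := by
    have r1 : U * (2 / N) ≤ 4 * W := by
      calc U * (2 / (N : ℝ)) ≤ 2 * (2 / N) := by gcongr
        _ = 4 * E ^ 3 := by rw [hNinv]; field_simp; norm_num
        _ ≤ 4 * W := by linarith
    have r2 : j * (U ^ 2 * η) ≤ 128 * (T * W) := by
      rw [hN43'] at hj2
      calc j * (U ^ 2 * η) ≤ T * (1 / E ^ 4) * (2 ^ 2 * η) := by gcongr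
        _ = 128 * (T * (y * E ^ 2)) := by rw [hη, hNinv]; field_simp; norm_num
        _ ≤ 128 * (T * (y * E)) := by gcongr
        _ ≤ _ := by gcongr
    linarith
  have u1 : (N : ℝ) ^ 2 * kernelQ N ccr A j a b ≤ (1 - ε')⁻¹ * (1 + ε') := by
    calc _ ≤ (N : ℝ) ^ 2 * (U ^ k * (1 / (N : ℝ) ^ 2 + e1)) := by gcongr
      _ = U ^ k * (1 + (N : ℝ) ^ 2 * e1) := by field_simp
      _ ≤ _ := by gcongr; exact (by positivity : (0 : ℝ) ≤ U ^ k).trans hUk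
  have u2 : (1 - ε')⁻¹ * (1 + ε') ≤ 1 + ε := by
    exact aux_u hε hε'0 hε'1 hε'2
  have l1 : (1 - 2 * ε') * (1 - ε') ≤ (N : ℝ) ^ 2 * kernelQ N ccr A j a b := by
    calc (1 - 2 * ε') * (1 - ε') ≤
        ((N : ℝ) ^ 2 * (1 / (N : ℝ) ^ 2 - e1 - e2)) * (1 - U * (2 / N) - j * (U ^ 2 * η)) := by
          have : (N : ℝ) ^ 2 * (1 / (N : ℝ) ^ 2 - e1 - e2) =
            1 - (N : ℝ) ^ 2 * e1 - (N : ℝ) ^ 2 * e2 := by field_simp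
          rw [this]
          refine mul_le_mul (by linarith) (by linarith) (by linarith) (by linarith)
      _ = (N : ℝ) ^ 2 * ((1 / (N : ℝ) ^ 2 - e1 - e2) *
            (1 - U * (2 / N) - j * (U ^ 2 * η))) := by ring
      _ ≤ _ := by gcongr
  rw [abs_le]
  constructor
  · have := mul_pos hε'0 hε'0
    linarith
  · linarith
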